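/- (Beukers) For n ≥ 0 let I_n = ∫₀¹∫₀¹∫₀¹ (uⁿ(1−u)ⁿ vⁿ(1−v)ⁿ wⁿ(1−w)ⁿ) / (1 − w(1−uv))^{n+1} du dv dw. Then: (1) lim_{n→∞} (log I_n)/n = log((√2 − 1)⁴), since the maximum of u(1−u)v(1−v)w(1−w)/(1 − w(1−uv)) on the unit cube [0,1]³ equals (√2 − 1)⁴; (2) for every n there exist a_n ∈ ℤ and b_n ∈ ℚ with 2·d_n³·b_n ∈ ℤ such that I_n = 2·(a_n·ζ(3) − b_n). -/

import Mathlib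

/-- The values of the Riemann zeta function at integers `s ≥ 2`,
as a real number: `ζ(s) = ∑_{n ≥ 1} n^{-s}`. -/
noncomputable def zetaR (s : ℕ) : ℝ := ∑' n : ℕ, 1 / (n + 1 : ℝ) ^ s

/-- `d_n`: the least common multiple of `1, 2, …, n`. -/
def dlcm (n : ℕ) : ℕ := (Finset.Icc 1 n).lcm id

/-- Beukers' triple integral
`I_n = ∫₀¹∫₀¹∫₀¹ (u(1-u)v(1-v)w(1-w))ⁿ / (1-w(1-uv))^{n+1} du dv dw`. -/
noncomputable def beukersI (n : ℕ) : ℝ :=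
  ∫ u in (0:ℝ)..1, ∫ v in (0:ℝ)..1, ∫ w in (0:ℝ)..1,
    (u ^ n * (1 - u) ^ n * v ^ n * (1 - v) ^ n * w ^ n * (1 - w) ^ n) /
      (1 - w * (1 - u * v)) ^ (n + 1)

open MeasureTheory Set Filter Topology Polynomial

/-- Lebesgue measure on the open unit interval. -/
noncomputable abbrev unitMeasure : Measure ℝ := volume.restrict (Ioo 0 1)

/-- Lebesgue measure on the open unit cube. -/
noncomputable abbrev cubeMeasure : Measure (ℝ × ℝ × ℝ) :=
  unitMeasure.prod (unitMeasure.prod unitMeasure)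

theorem cubeMeasure_eq_restrict :
    cubeMeasure = volume.restrict (Ioo (0 : ℝ) 1 ×ˢ (Ioo (0 : ℝ) 1 ×ˢ Ioo (0 : ℝ) 1)) := by
  rw [cubeMeasure, Measure.prod_restrict, Measure.prod_restrict]
  rfl

theorem ae_squareMeasure :
    ∀ᵐ p ∂unitMeasure.prod unitMeasure, p.1 ∈ Ioo (0 : ℝ) 1 ∧ p.2 ∈ Ioo (0 : ℝ) 1 := by
  rw [Measure.prod_restrict]
  exact ae_restrict_mem (measurableSet_Ioo.prod measurableSet_Ioo)

theorem ae_cubeMeasure : ∀ᵐ p ∂cubeMeasure,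
    p.1 ∈ Ioo (0 : ℝ) 1 ∧ p.2.1 ∈ Ioo (0 : ℝ) 1 ∧ p.2.2 ∈ Ioo (0 : ℝ) 1 := by
  rw [cubeMeasure_eq_restrict]
  exact ae_restrict_mem (measurableSet_Ioo.prod (measurableSet_Ioo.prod measurableSet_Ioo))

theorem integral_unitMeasure (f : ℝ → ℝ) : ∫ x, f x ∂unitMeasure = ∫ x in (0 : ℝ)..1, f x := by
  rw [intervalIntegral.integral_of_le zero_le_one, integral_Ioc_eq_integral_Ioo]

theorem integral_unitMeasure_congr {f g : ℝ → ℝ} (h : ∀ x ∈ Ioo (0 : ℝ) 1, f x = g x) :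
    ∫ x, f x ∂unitMeasure = ∫ x, g x ∂unitMeasure :=
  setIntegral_congr_fun measurableSet_Ioo h

section Denominator

variable {x y z : ℝ}

theorem beukersDenom_pos (hx : 0 < x) (hy : 0 < y) (hz : z ∈ Ioo (0 : ℝ) 1) :
    0 < 1 - z * (1 - x * y) := by
  have : 0 < z * (x * y) := mul_pos hz.1 (mul_pos hx hy)
  nlinarith [hz.2]

theorem inv_beukersDenom_le (hx : x ∈ Ioo (0 : ℝ) 1) (hy : y ∈ Ioo (0 : ℝ) 1)
    (hz : z ∈ Ioo (0 : ℝ) 1) :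
    (1 - z * (1 - x * y))⁻¹ ≤
      x ^ (-(1 / 2) : ℝ) * (y ^ (-(1 / 2) : ℝ) * (1 - z) ^ (-(1 / 2) : ℝ)) := by
  obtain ⟨hx0, hx1⟩ := hx
  obtain ⟨hy0, hy1⟩ := hy
  have hD := beukersDenom_pos hx0 hy0 hz
  obtain ⟨hz0, hz1⟩ := hz
  have hxy : 0 < x * y := mul_pos hx0 hy0
  have hxy1 : x * y < 1 := by nlinarith
  have hhalf : (x * y + (1 - z)) / 2 ≤ 1 - z * (1 - x * y) := by
    nlinarith [mul_pos hz0 hxy, mul_pos (sub_pos.2 hz1) (sub_pos.2 hxy1)]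
  have hsq : x * (y * (1 - z)) ≤ (1 - z * (1 - x * y)) ^ 2 := by
    nlinarith [sq_nonneg (x * y - (1 - z))]
  rw [← Real.mul_rpow hy0.le (sub_nonneg.2 hz1.le),
    ← Real.mul_rpow hx0.le (mul_nonneg hy0.le (sub_nonneg.2 hz1.le))]
  refine le_trans (le_of_eq ?_) (Real.rpow_le_rpow_of_nonpos
    (mul_pos hx0 (mul_pos hy0 (sub_pos.2 hz1))) hsq (by norm_num))
  rw [← Real.rpow_natCast, ← Real.rpow_mul hD.le, ← Real.rpow_neg_one]
  norm_num

end Denominator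

theorem integrable_rpow_neg_half :
    Integrable (fun x : ℝ => x ^ (-(1 / 2) : ℝ)) unitMeasure :=
  (intervalIntegrable_iff_integrableOn_Ioo_of_le zero_le_one).1
    (intervalIntegral.intervalIntegrable_rpow' (by norm_num))

theorem integrable_one_sub_rpow_neg_half :
    Integrable (fun x : ℝ => (1 - x) ^ (-(1 / 2) : ℝ)) unitMeasure := by
  have h := (intervalIntegral.intervalIntegrable_rpow' (r := -(1 / 2)) (a := 0) (b := 1)
    (by norm_num)).comp_sub_left 1
  refine (intervalIntegrable_iff_integrableOn_Ioo_of_le zero_le_one).1 ?_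
  simpa using h.symm

/-- A measurable function dominated by a multiple of `1 / (1 - z (1 - x y))` is integrable on the
unit cube. -/
theorem integrable_cube_of_le {f : ℝ → ℝ → ℝ → ℝ}
    (hf : Measurable fun p : ℝ × ℝ × ℝ => f p.1 p.2.1 p.2.2) (C : ℝ)
    (h : ∀ x ∈ Ioo (0 : ℝ) 1, ∀ y ∈ Ioo (0 : ℝ) 1, ∀ z ∈ Ioo (0 : ℝ) 1,
      |f x y z| ≤ C * (1 - z * (1 - x * y))⁻¹) :
    Integrable (fun p : ℝ × ℝ × ℝ => f p.1 p.2.1 p.2.2) cubeMeasure := by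
  refine ((integrable_rpow_neg_half.mul_prod (integrable_rpow_neg_half.mul_prod
    integrable_one_sub_rpow_neg_half)).const_mul C).mono' hf.aestronglyMeasurable ?_
  filter_upwards [ae_cubeMeasure] with p hp
  obtain ⟨hx, hy, hz⟩ := hp
  have hD := beukersDenom_pos hx.1 hy.1 hz
  have hC : 0 ≤ C := by
    have := (abs_nonneg _).trans (h _ hx _ hy _ hz)
    exact nonneg_of_mul_nonneg_left this (inv_pos.2 hD)
  exact (h _ hx _ hy _ hz).trans
    (mul_le_mul_of_nonneg_left (inv_beukersDenom_le hx hy hz) hC)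

section Fubini

variable {f : ℝ → ℝ → ℝ → ℝ}

theorem integral_cube (hf : Integrable (fun p : ℝ × ℝ × ℝ => f p.1 p.2.1 p.2.2) cubeMeasure) :
    ∫ p, f p.1 p.2.1 p.2.2 ∂cubeMeasure =
      ∫ x, ∫ y, ∫ z, f x y z ∂unitMeasure ∂unitMeasure ∂unitMeasure := by
  rw [integral_prod _ hf]
  refine integral_congr_ae ?_
  filter_upwards [hf.prod_right_ae] with x hx
  exact integral_prod _ hx

theorem integral_swap_inner
    (hf : Integrable (fun p : ℝ × ℝ × ℝ => f p.1 p.2.1 p.2.2) cubeMeasure) :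
    ∫ x, ∫ y, ∫ z, f x y z ∂unitMeasure ∂unitMeasure ∂unitMeasure =
      ∫ x, ∫ z, ∫ y, f x y z ∂unitMeasure ∂unitMeasure ∂unitMeasure := by
  refine integral_congr_ae ?_
  filter_upwards [hf.prod_right_ae] with x hx
  exact integral_integral_swap hx

theorem integrable_integral_inner
    (hf : Integrable (fun p : ℝ × ℝ × ℝ => f p.1 p.2.1 p.2.2) cubeMeasure) :
    Integrable (fun p : ℝ × ℝ => ∫ z, f p.1 p.2 z ∂unitMeasure) (unitMeasure.prod unitMeasure) :=
  ((measurePreserving_prodAssoc unitMeasure unitMeasure unitMeasure).integrable_comp_of_integrable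
    hf).integral_prod_left

theorem integral_square
    (hf : Integrable (fun p : ℝ × ℝ × ℝ => f p.1 p.2.1 p.2.2) cubeMeasure) :
    ∫ p, ∫ z, f p.1 p.2 z ∂unitMeasure ∂unitMeasure.prod unitMeasure =
      ∫ x, ∫ y, ∫ z, f x y z ∂unitMeasure ∂unitMeasure ∂unitMeasure :=
  integral_prod _ (integrable_integral_inner hf)

theorem integral_swap_outer
    (hf : Integrable (fun p : ℝ × ℝ × ℝ => f p.1 p.2.1 p.2.2) cubeMeasure) :
    ∫ x, ∫ y, ∫ z, f x y z ∂unitMeasure ∂unitMeasure ∂unitMeasure =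
      ∫ y, ∫ x, ∫ z, f x y z ∂unitMeasure ∂unitMeasure ∂unitMeasure :=
  integral_integral_swap (f := fun x y => ∫ z, f x y z ∂unitMeasure) (integrable_integral_inner hf)

end Fubini

section OneVariable

theorem integral_inv_beukersDenom {t : ℝ} (ht : t ∈ Ioo (0 : ℝ) 1) :
    ∫ z, (1 - z * (1 - t))⁻¹ ∂unitMeasure = -Real.log t / (1 - t) := by
  obtain ⟨h0, h1⟩ := ht
  have hpos : ∀ z ∈ uIcc (0 : ℝ) 1, 0 < 1 - z * (1 - t) := by
    intro z hz
    rw [uIcc_of_le zero_le_one] at hz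
    nlinarith [hz.1, hz.2]
  have ht1 : 1 - t ≠ 0 := by linarith
  rw [integral_unitMeasure, intervalIntegral.integral_eq_sub_of_hasDerivAt
    (f := fun z => -Real.log (1 - z * (1 - t)) / (1 - t))]
  · simp
  · intro z hz
    have hz' := (hpos z hz).ne'
    have := ((((hasDerivAt_id z).mul_const (1 - t)).const_sub 1).log hz').neg.div_const (1 - t)
    refine HasDerivAt.congr_deriv this ?_
    simp only [id]
    field_simp
  · refine ContinuousOn.intervalIntegrable ?_
    exact ContinuousOn.inv₀ (by fun_prop) fun z hz => (hpos z hz).ne'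

/-- The effect on Beukers' integrand of the involution `z ↦ (1 - z) / (1 - (1 - t) z)`. -/
theorem integral_beukers_substitution (n : ℕ) {t : ℝ} (ht : t ∈ Ioo (0 : ℝ) 1) :
    ∫ w, (1 - w) ^ n / (1 - w * (1 - t)) ∂unitMeasure =
      ∫ z, (t * z) ^ n / (1 - z * (1 - t)) ^ (n + 1) ∂unitMeasure := by
  obtain ⟨h0, h1⟩ := ht
  have hpos : ∀ z ∈ Icc (0 : ℝ) 1, 0 < 1 - z * (1 - t) := by
    intro z hz
    nlinarith [hz.1, hz.2]
  set φ : ℝ → ℝ := fun z => (1 - z) / (1 - z * (1 - t)) with hφ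
  have hder : ∀ z ∈ uIcc (0 : ℝ) 1, HasDerivAt φ (-t / (1 - z * (1 - t)) ^ 2) z := by
    intro z hz
    rw [uIcc_of_le zero_le_one] at hz
    have := ((hasDerivAt_id z).const_sub 1).div (((hasDerivAt_id z).mul_const (1 - t)).const_sub 1)
      (hpos z hz).ne'
    refine HasDerivAt.congr_deriv this ?_
    simp only [id]
    ring
  have hmap : ∀ z ∈ Icc (0 : ℝ) 1, φ z ∈ Icc (0 : ℝ) 1 := fun z hz =>
    ⟨div_nonneg (by linarith [hz.2]) (hpos z hz).le,
      (div_le_one (hpos z hz)).2 (by nlinarith [hz.1, hz.2])⟩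
  have key := intervalIntegral.integral_comp_mul_deriv' (a := 0) (b := 1) (f := φ)
    (g := fun w => (1 - w) ^ n / (1 - w * (1 - t))) hder
    (by
      rw [uIcc_of_le zero_le_one]
      exact ContinuousOn.div (by fun_prop) (by fun_prop) fun z hz => (pow_pos (hpos z hz) 2).ne')
    (by
      rw [uIcc_of_le zero_le_one]
      refine ContinuousOn.mono (s := Icc 0 1) ?_ (image_subset_iff.2 hmap)
      exact ContinuousOn.div (by fun_prop) (by fun_prop) fun z hz => (hpos z hz).ne')
  have hφ0 : φ 0 = 1 := by simp [hφ]
  have hφ1 : φ 1 = 0 := by simp [hφ]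
  rw [hφ0, hφ1, intervalIntegral.integral_symm 0 1] at key
  rw [integral_unitMeasure, integral_unitMeasure, ← neg_inj, ← key,
    ← intervalIntegral.integral_neg]
  refine intervalIntegral.integral_congr fun z hz => ?_
  rw [uIcc_of_le zero_le_one] at hz
  have hD := (hpos z hz).ne'
  have e1 : 1 - φ z = t * z / (1 - z * (1 - t)) := by
    simp only [hφ]
    field_simp
    ring
  have e2 : 1 - φ z * (1 - t) = t / (1 - z * (1 - t)) := by
    simp only [hφ]
    field_simp
    ring
  simp only [Function.comp, e1, e2, div_pow]
  field_simp
  ring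

/-- Repeated integration by parts against `1 / (a + b x)`. -/
theorem integral_iterate_derivative_div {a b : ℝ} (ha : 0 < a) (hb : 0 ≤ b) (k : ℕ) (Q : ℝ[X])
    (h0 : ∀ i < k, (derivative^[i] Q).eval 0 = 0) (h1 : ∀ i < k, (derivative^[i] Q).eval 1 = 0) :
    ∫ x in (0 : ℝ)..1, (derivative^[k] Q).eval x / (a + b * x) =
      k.factorial * b ^ k * ∫ x in (0 : ℝ)..1, Q.eval x / (a + b * x) ^ (k + 1) := by
  have hpos : ∀ x ∈ uIcc (0 : ℝ) 1, a + b * x ≠ 0 := by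
    intro x hx
    rw [uIcc_of_le zero_le_one] at hx
    nlinarith [mul_nonneg hb hx.1]
  induction k generalizing Q with
  | zero => simp
  | succ k ih =>
    rw [Function.iterate_succ_apply, ih (derivative Q)
      (fun i hi => by simpa using h0 (i + 1) (by lia))
      (fun i hi => by simpa using h1 (i + 1) (by lia))]
    have hparts := intervalIntegral.integral_mul_deriv_eq_deriv_mul (a := 0) (b := 1)
      (u := fun x => ((a + b * x) ^ (k + 1))⁻¹) (v := fun x => Q.eval x)
      (u' := fun x => -((k + 1) * b) / (a + b * x) ^ (k + 2)) (v' := fun x => (derivative Q).eval x)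
      (fun x hx => by
        have := ((((hasDerivAt_id x).const_mul b).const_add a).pow (k + 1)).inv
          (pow_ne_zero _ (hpos x hx))
        refine HasDerivAt.congr_deriv this ?_
        have := hpos x hx
        simp only [id, Nat.cast_add, Nat.cast_one, Nat.add_sub_cancel, mul_one, Pi.pow_apply]
        field_simp
        ring)
      (fun x _ => Q.hasDerivAt x)
      (ContinuousOn.intervalIntegrable
        (ContinuousOn.div (by fun_prop) (by fun_prop) fun x hx => pow_ne_zero _ (hpos x hx)))
      ((derivative Q).continuous.intervalIntegrable _ _)
    have hQ0 : Q.eval 0 = 0 := h0 0 (by lia)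
    have hQ1 : Q.eval 1 = 0 := h1 0 (by lia)
    simp only [hQ0, hQ1, mul_zero, sub_zero, zero_sub] at hparts
    have e1 : ∫ x in (0 : ℝ)..1, (derivative Q).eval x / (a + b * x) ^ (k + 1) =
        (k + 1) * b * ∫ x in (0 : ℝ)..1, Q.eval x / (a + b * x) ^ (k + 1 + 1) := by
      calc _ = ∫ x in (0 : ℝ)..1, ((a + b * x) ^ (k + 1))⁻¹ * (derivative Q).eval x := by
            simp only [div_eq_inv_mul]
        _ = _ := hparts
        _ = _ := by
          rw [← intervalIntegral.integral_neg, ← intervalIntegral.integral_const_mul]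
          refine intervalIntegral.integral_congr fun x _ => ?_
          ring
    rw [e1, Nat.factorial_succ]
    push_cast
    ring

theorem factorial_mul_aeval_shiftedLegendre (n : ℕ) (x : ℝ) :
    n.factorial * aeval x (shiftedLegendre n) =
      (derivative^[n] (X ^ n * (1 - X) ^ n : ℝ[X])).eval x := by
  have h := congrArg (fun q : ℤ[X] => aeval x q) (factorial_mul_shiftedLegendre_eq n)
  simp only [map_mul, map_natCast] at h
  rw [h, aeval_def, ← eval_map, ← iterate_derivative_map]
  simp

/-- Rodrigues' formula integrated against `1 / (a + b x)`. -/
theorem integral_shiftedLegendre_div {a b : ℝ} (ha : 0 < a) (hb : 0 ≤ b) (n : ℕ) :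
    ∫ x, aeval x (shiftedLegendre n) / (a + b * x) ∂unitMeasure =
      ∫ x, (b * x) ^ n * (1 - x) ^ n / (a + b * x) ^ (n + 1) ∂unitMeasure := by
  have h := integral_iterate_derivative_div ha hb n (X ^ n * (1 - X) ^ n)
    (fun i hi => by
      have : (X : ℝ[X]) ^ (n - i) ∣ derivative^[i] (X ^ n * (1 - X) ^ n) :=
        pow_sub_dvd_iterate_derivative_of_pow_dvd i (Dvd.intro _ rfl)
      obtain ⟨q, hq⟩ := this
      simp [hq, Nat.sub_eq_zero_iff_le, hi])
    (fun i hi => by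
      have : (1 - X : ℝ[X]) ^ (n - i) ∣ derivative^[i] (X ^ n * (1 - X) ^ n) :=
        pow_sub_dvd_iterate_derivative_of_pow_dvd i (Dvd.intro_left _ rfl)
      obtain ⟨q, hq⟩ := this
      simp [hq, Nat.sub_eq_zero_iff_le, hi])
  simp only [← factorial_mul_aeval_shiftedLegendre, mul_div_assoc] at h
  rw [intervalIntegral.integral_const_mul, mul_assoc] at h
  rw [integral_unitMeasure, integral_unitMeasure,
    mul_left_cancel₀ (Nat.cast_ne_zero.2 n.factorial_ne_zero) h,
    ← intervalIntegral.integral_const_mul]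
  refine intervalIntegral.integral_congr fun x _ => ?_
  simp only [eval_mul, eval_pow, eval_X, eval_sub, eval_one]
  ring

end OneVariable

section LegendreRepresentation

theorem integrable_cube_mul_inv {g : ℝ → ℝ → ℝ → ℝ}
    (hg : Measurable fun p : ℝ × ℝ × ℝ => g p.1 p.2.1 p.2.2) (C : ℝ)
    (h : ∀ x ∈ Ioo (0 : ℝ) 1, ∀ y ∈ Ioo (0 : ℝ) 1, ∀ z ∈ Ioo (0 : ℝ) 1, |g x y z| ≤ C) :
    Integrable (fun p : ℝ × ℝ × ℝ => g p.1 p.2.1 p.2.2 / (1 - p.2.2 * (1 - p.1 * p.2.1)))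
      cubeMeasure := by
  refine integrable_cube_of_le (f := fun x y z => g x y z / (1 - z * (1 - x * y)))
    (hg.div (by fun_prop)) C fun x hx y hy z hz => ?_
  have hD := beukersDenom_pos hx.1 hy.1 hz
  rw [abs_div, abs_of_pos hD, div_eq_mul_inv]
  exact mul_le_mul_of_nonneg_right (h x hx y hy z hz) (inv_pos.2 hD).le

theorem integrable_cube_mul_pow_div (n : ℕ) {g : ℝ → ℝ → ℝ → ℝ}
    (hg : Measurable fun p : ℝ × ℝ × ℝ => g p.1 p.2.1 p.2.2) (C : ℝ)
    (h : ∀ x ∈ Ioo (0 : ℝ) 1, ∀ y ∈ Ioo (0 : ℝ) 1, ∀ z ∈ Ioo (0 : ℝ) 1, |g x y z| ≤ C) :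
    Integrable (fun p : ℝ × ℝ × ℝ => g p.1 p.2.1 p.2.2 * (p.1 * p.2.1 * p.2.2) ^ n /
      (1 - p.2.2 * (1 - p.1 * p.2.1)) ^ (n + 1)) cubeMeasure := by
  have := integrable_cube_mul_inv
    (g := fun x y z => g x y z * (x * y * z / (1 - z * (1 - x * y))) ^ n)
    (hg.mul (by fun_prop)) C fun x hx y hy z hz => ?_
  · refine this.congr (ae_of_all _ fun p => ?_)
    simp only [pow_succ, div_eq_mul_inv, mul_inv]
    ring
  · have hD := beukersDenom_pos hx.1 hy.1 hz
    have hxyz : 0 < x * y * z := mul_pos (mul_pos hx.1 hy.1) hz.1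
    have hle : x * y * z / (1 - z * (1 - x * y)) ≤ 1 :=
      (div_le_one hD).2 (by nlinarith [hz.2])
    have hnn : 0 ≤ x * y * z / (1 - z * (1 - x * y)) := (div_pos hxyz hD).le
    rw [abs_mul, abs_of_nonneg (pow_nonneg hnn n)]
    exact (mul_le_of_le_one_right (abs_nonneg _) (pow_le_one₀ hnn hle)).trans (h x hx y hy z hz)

theorem abs_one_sub_pow_le_one {x : ℝ} (hx : x ∈ Ioo (0 : ℝ) 1) (n : ℕ) : |(1 - x) ^ n| ≤ 1 := by
  rw [abs_of_nonneg (pow_nonneg (sub_nonneg.2 hx.2.le) n)]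
  exact pow_le_one₀ (sub_nonneg.2 hx.2.le) (by linarith [hx.1])

theorem integrable_beukersIntegrand (n : ℕ) :
    Integrable (fun p : ℝ × ℝ × ℝ => (p.1 ^ n * (1 - p.1) ^ n * p.2.1 ^ n * (1 - p.2.1) ^ n *
      p.2.2 ^ n * (1 - p.2.2) ^ n) / (1 - p.2.2 * (1 - p.1 * p.2.1)) ^ (n + 1)) cubeMeasure := by
  refine (integrable_cube_mul_pow_div n
    (g := fun x y z => (1 - x) ^ n * (1 - y) ^ n * (1 - z) ^ n) (by fun_prop) 1
    fun x hx y hy z hz => ?_).congr (ae_of_all _ fun p => ?_)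
  · rw [abs_mul, abs_mul]
    exact mul_le_one₀ (mul_le_one₀ (abs_one_sub_pow_le_one hx n) (abs_nonneg _)
      (abs_one_sub_pow_le_one hy n)) (abs_nonneg _) (abs_one_sub_pow_le_one hz n)
  · simp only [mul_pow]
    ring

theorem beukersI_eq_iterated (n : ℕ) :
    beukersI n = ∫ u, ∫ v, ∫ w, (u ^ n * (1 - u) ^ n * v ^ n * (1 - v) ^ n * w ^ n * (1 - w) ^ n) /
      (1 - w * (1 - u * v)) ^ (n + 1) ∂unitMeasure ∂unitMeasure ∂unitMeasure := by
  simp only [beukersI, integral_unitMeasure]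

theorem exists_abs_aeval_le (p : ℤ[X]) : ∃ C, ∀ x ∈ Ioo (0 : ℝ) 1, |aeval x p| ≤ C := by
  obtain ⟨C, hC⟩ := isCompact_Icc.exists_bound_of_continuousOn (s := Icc (0 : ℝ) 1)
    (p.continuous_aeval (A := ℝ)).continuousOn
  exact ⟨C, fun x hx => hC x (Ioo_subset_Icc_self hx)⟩

theorem integrable_legendre_mul_legendre (n : ℕ) :
    Integrable (fun p : ℝ × ℝ × ℝ => aeval p.1 (shiftedLegendre n) *
      aeval p.2.1 (shiftedLegendre n) / (1 - p.2.2 * (1 - p.1 * p.2.1))) cubeMeasure := by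
  obtain ⟨C, hC⟩ := exists_abs_aeval_le (shiftedLegendre n)
  have hP : Measurable fun x : ℝ => aeval x (shiftedLegendre n) :=
    (shiftedLegendre n).continuous_aeval.measurable
  refine integrable_cube_mul_inv
    (g := fun x y _ => aeval x (shiftedLegendre n) * aeval y (shiftedLegendre n))
    ((hP.comp measurable_fst).mul (hP.comp (measurable_fst.comp measurable_snd))) (C * C)
    fun x hx y hy z hz => ?_
  rw [abs_mul]
  exact mul_le_mul (hC x hx) (hC y hy) (abs_nonneg _) ((abs_nonneg _).trans (hC x hx))

/-- Beukers' integral as an integral of a product of Legendre polynomials. -/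
theorem beukersI_eq_legendre (n : ℕ) :
    beukersI n = ∫ p, aeval p.1 (shiftedLegendre n) * aeval p.2.1 (shiftedLegendre n) /
      (1 - p.2.2 * (1 - p.1 * p.2.1)) ∂cubeMeasure := by
  obtain ⟨C, hC⟩ := exists_abs_aeval_le (shiftedLegendre n)
  set P : ℝ → ℝ := fun x => aeval x (shiftedLegendre n)
  have hPm : Measurable P := (shiftedLegendre n).continuous_aeval.measurable
  have hPm1 : Measurable fun p : ℝ × ℝ × ℝ => P p.1 := hPm.comp measurable_fst
  have hPm2 : Measurable fun p : ℝ × ℝ × ℝ => P p.2.1 :=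
    hPm.comp (measurable_fst.comp measurable_snd)
  have hbound : ∀ x ∈ Ioo (0 : ℝ) 1, ∀ y ∈ Ioo (0 : ℝ) 1, |(1 - x) ^ n * P y| ≤ C := by
    intro x hx y hy
    rw [abs_mul]
    exact (mul_le_of_le_one_left (abs_nonneg _) (abs_one_sub_pow_le_one hx n)).trans (hC y hy)
  have hF1 := integrable_beukersIntegrand n
  have hF2 := integrable_cube_mul_inv (g := fun u v w => (1 - u) ^ n * P v * (1 - w) ^ n)
    (by fun_prop) C fun x hx y hy z hz => by
      rw [abs_mul]
      exact (mul_le_of_le_one_right (abs_nonneg _) (abs_one_sub_pow_le_one hz n)).trans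
        (hbound x hx y hy)
  have hF3 := integrable_cube_mul_pow_div n (g := fun u v _ => (1 - u) ^ n * P v)
    (by fun_prop) C fun x hx y hy _ _ => hbound x hx y hy
  have hF3' := integrable_cube_mul_pow_div n (g := fun v u _ => (1 - u) ^ n * P v)
    (by fun_prop) C fun x hx y hy _ _ => hbound y hy x hx
  have hF4 : Integrable (fun p : ℝ × ℝ × ℝ => P p.1 * P p.2.1 /
      (1 - p.2.2 * (1 - p.1 * p.2.1))) cubeMeasure := integrable_legendre_mul_legendre n
  rw [integral_cube (f := fun v u z => P v * P u / (1 - z * (1 - v * u))) hF4,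
    beukersI_eq_iterated,
    integral_swap_inner (f := fun u v w => (u ^ n * (1 - u) ^ n * v ^ n * (1 - v) ^ n * w ^ n *
      (1 - w) ^ n) / (1 - w * (1 - u * v)) ^ (n + 1)) hF1]
  calc _ = ∫ u, ∫ w, ∫ v, (1 - u) ^ n * P v * (1 - w) ^ n / (1 - w * (1 - u * v))
          ∂unitMeasure ∂unitMeasure ∂unitMeasure := by
        refine integral_unitMeasure_congr fun u hu => integral_unitMeasure_congr fun w hw => ?_
        have h := integral_shiftedLegendre_div (sub_pos.2 hw.2) (mul_pos hu.1 hw.1).le n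
        calc _ = ∫ v, (1 - u) ^ n * (1 - w) ^ n *
                ((u * w * v) ^ n * (1 - v) ^ n / (1 - w + u * w * v) ^ (n + 1)) ∂unitMeasure := by
              congr 1 with v
              rw [show 1 - w * (1 - u * v) = 1 - w + u * w * v by ring]
              simp only [mul_pow]
              ring
          _ = ∫ v, (1 - u) ^ n * (1 - w) ^ n * (P v / (1 - w + u * w * v)) ∂unitMeasure := by
              rw [integral_const_mul, integral_const_mul, ← h]
          _ = _ := by
              congr 1 with v
              rw [show 1 - w * (1 - u * v) = 1 - w + u * w * v by ring]
              ring
    _ = ∫ u, ∫ v, ∫ w, (1 - u) ^ n * P v * (1 - w) ^ n / (1 - w * (1 - u * v))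
          ∂unitMeasure ∂unitMeasure ∂unitMeasure := (integral_swap_inner hF2).symm
    _ = ∫ u, ∫ v, ∫ z, (1 - u) ^ n * P v * (u * v * z) ^ n / (1 - z * (1 - u * v)) ^ (n + 1)
          ∂unitMeasure ∂unitMeasure ∂unitMeasure := by
        refine integral_unitMeasure_congr fun u hu => integral_unitMeasure_congr fun v hv => ?_
        simp only [mul_div_assoc _ (_ ^ n)]
        rw [integral_const_mul, integral_const_mul, integral_beukers_substitution n
          ⟨mul_pos hu.1 hv.1, by nlinarith [hu.1, hu.2, hv.1, hv.2]⟩]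
    _ = ∫ v, ∫ u, ∫ z, (1 - u) ^ n * P v * (u * v * z) ^ n / (1 - z * (1 - u * v)) ^ (n + 1)
          ∂unitMeasure ∂unitMeasure ∂unitMeasure := integral_swap_outer hF3
    _ = ∫ v, ∫ u, ∫ z, (1 - u) ^ n * P v * (v * u * z) ^ n / (1 - z * (1 - v * u)) ^ (n + 1)
          ∂unitMeasure ∂unitMeasure ∂unitMeasure := by
        congr! 10 with v u z <;> ring
    _ = ∫ v, ∫ z, ∫ u, (1 - u) ^ n * P v * (v * u * z) ^ n / (1 - z * (1 - v * u)) ^ (n + 1)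
          ∂unitMeasure ∂unitMeasure ∂unitMeasure := integral_swap_inner hF3'
    _ = ∫ v, ∫ z, ∫ u, P v * P u / (1 - z * (1 - v * u))
          ∂unitMeasure ∂unitMeasure ∂unitMeasure := by
        refine integral_unitMeasure_congr fun v hv => integral_unitMeasure_congr fun z hz => ?_
        have h := integral_shiftedLegendre_div (sub_pos.2 hz.2) (mul_pos hv.1 hz.1).le n
        calc _ = ∫ u, P v * ((v * z * u) ^ n * (1 - u) ^ n / (1 - z + v * z * u) ^ (n + 1))
                ∂unitMeasure := by
              congr 1 with u
              rw [show 1 - z * (1 - v * u) = 1 - z + v * z * u by ring]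
              simp only [mul_pow]
              ring
          _ = ∫ u, P v * (P u / (1 - z + v * z * u)) ∂unitMeasure := by
              rw [integral_const_mul, integral_const_mul, ← h]
          _ = _ := by
              congr 1 with u
              rw [show 1 - z * (1 - v * u) = 1 - z + v * z * u by ring]
              ring
    _ = _ := (integral_swap_inner hF4).symm

end LegendreRepresentation

section Monomials

theorem hasDerivAt_pow_mul_log_antideriv (m : ℕ) {x : ℝ} (hx : 0 < x) :
    HasDerivAt (fun x : ℝ => x ^ (m + 1) / (m + 1) ^ 2 - x ^ m * (x * Real.log x) / (m + 1))
      (x ^ m * (-Real.log x)) x := by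
  have h1 := (hasDerivAt_pow (m + 1) x).div_const (((m : ℝ) + 1) ^ 2)
  have h2 := ((hasDerivAt_pow (m + 1) x).mul (Real.hasDerivAt_log hx.ne')).div_const ((m : ℝ) + 1)
  refine ((h1.sub h2).congr_of_eventuallyEq (Eventually.of_forall fun y => ?_)).congr_deriv ?_
  · simp only [Pi.sub_apply, Pi.mul_apply]
    ring
  · have := Nat.cast_add_one_ne_zero (R := ℝ) m
    simp only [Nat.add_sub_cancel]
    push_cast
    field_simp
    ring

theorem continuousOn_pow_mul_log_antideriv (m : ℕ) :
    ContinuousOn (fun x : ℝ => x ^ (m + 1) / (m + 1) ^ 2 - x ^ m * (x * Real.log x) / (m + 1))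
      (Icc 0 1) := by
  have := Real.continuous_mul_log
  fun_prop

theorem integrable_pow_mul_neg_log (m : ℕ) :
    Integrable (fun x : ℝ => x ^ m * (-Real.log x)) unitMeasure :=
  (intervalIntegral.integrableOn_deriv_of_nonneg (continuousOn_pow_mul_log_antideriv m)
    (fun _ hx => hasDerivAt_pow_mul_log_antideriv m hx.1)
    fun _ hx => mul_nonneg (pow_nonneg hx.1.le m)
      (neg_nonneg.2 (Real.log_nonpos hx.1.le hx.2.le))).mono_set Ioo_subset_Ioc_self

theorem integral_pow_mul_neg_log (m : ℕ) :
    ∫ x, x ^ m * (-Real.log x) ∂unitMeasure = 1 / ((m : ℝ) + 1) ^ 2 := by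
  rw [integral_unitMeasure, intervalIntegral.integral_eq_sub_of_hasDerivAt_of_le zero_le_one
    (continuousOn_pow_mul_log_antideriv m) (fun _ hx => hasDerivAt_pow_mul_log_antideriv m hx.1)
    ((intervalIntegrable_iff_integrableOn_Ioo_of_le zero_le_one).2 (integrable_pow_mul_neg_log m))]
  simp

theorem integrable_pow_unitMeasure (m : ℕ) : Integrable (fun x : ℝ => x ^ m) unitMeasure :=
  (intervalIntegrable_iff_integrableOn_Ioo_of_le zero_le_one).1
    ((continuous_pow m).intervalIntegrable _ _)

theorem integral_pow_unitMeasure (m : ℕ) : ∫ x, x ^ m ∂unitMeasure = 1 / ((m : ℝ) + 1) := by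
  rw [integral_unitMeasure, integral_pow]
  simp

/-- The `k`-th term in the expansion of the integral of `x ^ r y ^ s / (1 - z (1 - x y))`. -/
noncomputable def beukersTerm (r s k : ℕ) : ℝ :=
  1 / ((k + r : ℝ) + 1) ^ 2 * (1 / ((k + s : ℝ) + 1)) +
    1 / ((k + r : ℝ) + 1) * (1 / ((k + s : ℝ) + 1) ^ 2)

theorem beukersTerm_comm (r s k : ℕ) : beukersTerm r s k = beukersTerm s r k := by
  simp only [beukersTerm]
  ring

theorem summable_one_div_succ_pow {p : ℕ} (hp : 1 < p) :
    Summable fun k : ℕ => 1 / ((k : ℝ) + 1) ^ p := by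
  simpa using (summable_nat_add_iff 1).2 (Real.summable_one_div_nat_pow.2 hp)

theorem summable_beukersTerm (r s : ℕ) : Summable (beukersTerm r s) := by
  refine Summable.of_nonneg_of_le (fun k => by unfold beukersTerm; positivity) (fun k => ?_)
    ((summable_one_div_succ_pow (p := 3) (by norm_num)).mul_left 2)
  calc beukersTerm r s k
      = (1 / ((k + r : ℝ) + 1)) ^ 2 * (1 / ((k + s : ℝ) + 1)) +
        1 / ((k + r : ℝ) + 1) * (1 / ((k + s : ℝ) + 1)) ^ 2 := by
        simp only [beukersTerm, one_div, inv_pow]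
    _ ≤ (1 / ((k : ℝ) + 1)) ^ 2 * (1 / ((k : ℝ) + 1)) +
        1 / ((k : ℝ) + 1) * (1 / ((k : ℝ) + 1)) ^ 2 := by
        gcongr <;> simp
    _ = 2 * (1 / ((k : ℝ) + 1) ^ 3) := by
        field_simp
        ring

theorem hasSum_log_expansion (r s : ℕ) {x y : ℝ} (hx : x ∈ Ioo (0 : ℝ) 1)
    (hy : y ∈ Ioo (0 : ℝ) 1) :
    HasSum (fun k : ℕ => x ^ (k + r) * (-Real.log x) * y ^ (k + s) +
      x ^ (k + r) * (y ^ (k + s) * (-Real.log y)))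
      (∫ z, x ^ r * y ^ s / (1 - z * (1 - x * y)) ∂unitMeasure) := by
  have hxy : x * y ∈ Ioo (0 : ℝ) 1 :=
    ⟨mul_pos hx.1 hy.1, by nlinarith [hx.1, hx.2, hy.1, hy.2]⟩
  have hval : ∫ z, x ^ r * y ^ s / (1 - z * (1 - x * y)) ∂unitMeasure =
      x ^ r * y ^ s * (-Real.log (x * y)) * (1 - x * y)⁻¹ := by
    simp only [div_eq_mul_inv _ (1 - _ * (1 - x * y))]
    rw [integral_const_mul, integral_inv_beukersDenom hxy]
    ring
  rw [hval]
  refine ((hasSum_geometric_of_lt_one hxy.1.le hxy.2).mul_left _).congr_fun ?_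
  intro k
  rw [Real.log_mul hx.1.ne' hy.1.ne', mul_pow, pow_add, pow_add]
  ring

theorem integrable_monomial (r s : ℕ) :
    Integrable (fun p : ℝ × ℝ × ℝ => p.1 ^ r * p.2.1 ^ s / (1 - p.2.2 * (1 - p.1 * p.2.1)))
      cubeMeasure := by
  refine integrable_cube_mul_inv (g := fun x y _ => x ^ r * y ^ s) (by fun_prop) 1
    fun x hx y hy z _ => ?_
  rw [abs_of_pos (mul_pos (pow_pos hx.1 r) (pow_pos hy.1 s))]
  exact mul_le_one₀ (pow_le_one₀ hx.1.le hx.2.le) (pow_nonneg hy.1.le s)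
    (pow_le_one₀ hy.1.le hy.2.le)

theorem integral_monomial (r s : ℕ) :
    ∫ p, p.1 ^ r * p.2.1 ^ s / (1 - p.2.2 * (1 - p.1 * p.2.1)) ∂cubeMeasure =
      ∑' k, beukersTerm r s k := by
  let F : ℕ → ℝ × ℝ → ℝ := fun k p => p.1 ^ (k + r) * (-Real.log p.1) * p.2 ^ (k + s) +
    p.1 ^ (k + r) * (p.2 ^ (k + s) * (-Real.log p.2))
  have hi1 : ∀ k, Integrable (fun p : ℝ × ℝ => p.1 ^ (k + r) * (-Real.log p.1) * p.2 ^ (k + s))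
      (unitMeasure.prod unitMeasure) := fun k =>
    (integrable_pow_mul_neg_log _).mul_prod (integrable_pow_unitMeasure _)
  have hi2 : ∀ k, Integrable (fun p : ℝ × ℝ => p.1 ^ (k + r) * (p.2 ^ (k + s) * (-Real.log p.2)))
      (unitMeasure.prod unitMeasure) := fun k =>
    (integrable_pow_unitMeasure _).mul_prod (integrable_pow_mul_neg_log _)
  have hF : ∀ k, ∫ p, F k p ∂unitMeasure.prod unitMeasure = beukersTerm r s k := by
    intro k
    simp only [F]
    rw [integral_add (hi1 k) (hi2 k),
      integral_prod_mul (fun x : ℝ => x ^ (k + r) * (-Real.log x)) (fun y : ℝ => y ^ (k + s)),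
      integral_prod_mul (fun x : ℝ => x ^ (k + r)) (fun y : ℝ => y ^ (k + s) * (-Real.log y)),
      integral_pow_mul_neg_log, integral_pow_mul_neg_log, integral_pow_unitMeasure,
      integral_pow_unitMeasure, beukersTerm]
    push_cast
    rfl
  have hnorm : ∀ k, ∫ p, ‖F k p‖ ∂unitMeasure.prod unitMeasure = beukersTerm r s k := by
    intro k
    rw [← hF k]
    refine integral_congr_ae ?_
    filter_upwards [ae_squareMeasure] with p hp
    have hlx := neg_nonneg.2 (Real.log_nonpos hp.1.1.le hp.1.2.le)
    have hly := neg_nonneg.2 (Real.log_nonpos hp.2.1.le hp.2.2.le)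
    have hx := hp.1.1
    have hy := hp.2.1
    exact Real.norm_of_nonneg (by simp only [F]; positivity)
  have hsum := hasSum_integral_of_summable_integral_norm (F := F)
    (fun k => (hi1 k).add (hi2 k)) (by simpa only [hnorm] using summable_beukersTerm r s)
  simp only [hF] at hsum
  rw [hsum.tsum_eq, integral_cube (f := fun x y z => x ^ r * y ^ s / (1 - z * (1 - x * y)))
    (integrable_monomial r s), ← integral_square
    (f := fun x y z => x ^ r * y ^ s / (1 - z * (1 - x * y))) (integrable_monomial r s)]
  refine integral_congr_ae ?_
  filter_upwards [ae_squareMeasure] with p hp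
  exact (hasSum_log_expansion r s hp.1 hp.2).tsum_eq.symm

theorem tsum_beukersTerm_self (r : ℕ) :
    ∑' k, beukersTerm r r k = 2 * (zetaR 3 - ∑ i ∈ Finset.range r, 1 / ((i : ℝ) + 1) ^ 3) := by
  have h := (summable_one_div_succ_pow (p := 3) (by norm_num)).sum_add_tsum_nat_add r
  rw [zetaR, ← h, add_sub_cancel_left, ← tsum_mul_left]
  congr 1 with k
  simp only [beukersTerm]
  push_cast
  field_simp
  ring

theorem tsum_beukersTerm_of_lt {r s : ℕ} (h : s < r) :
    ∑' k, beukersTerm r s k =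
      1 / ((r : ℝ) - s) * ∑ i ∈ Finset.Ico s r, 1 / ((i : ℝ) + 1) ^ 2 := by
  have hsum := summable_one_div_succ_pow (p := 2) (by norm_num)
  have hr := hsum.sum_add_tsum_nat_add r
  have hs := hsum.sum_add_tsum_nat_add s
  have hrs : (r : ℝ) - s ≠ 0 := sub_ne_zero.2 (Nat.cast_lt.2 h).ne'
  have hterm : ∀ k, beukersTerm r s k = 1 / ((r : ℝ) - s) *
      (1 / (((k + s : ℕ) : ℝ) + 1) ^ 2 - 1 / (((k + r : ℕ) : ℝ) + 1) ^ 2) := by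
    intro k
    simp only [beukersTerm]
    push_cast
    have h1 : (k : ℝ) + r + 1 ≠ 0 := by positivity
    have h2 : (k : ℝ) + s + 1 ≠ 0 := by positivity
    field_simp
    ring
  simp only [hterm]
  rw [tsum_mul_left, ((summable_nat_add_iff s).2 hsum).tsum_sub ((summable_nat_add_iff r).2 hsum),
    Finset.sum_Ico_eq_sub _ h.le]
  congr 1
  linarith

end Monomials

section Arithmetic

theorem exists_int_mul_eq_dlcm {n i : ℕ} (h0 : 0 < i) (h : i ≤ n) :
    ∃ q : ℤ, (dlcm n : ℝ) = q * i := by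
  have : i ∣ dlcm n := Finset.dvd_lcm (f := id) (Finset.mem_Icc.2 ⟨h0, h⟩)
  obtain ⟨q, hq⟩ := this
  exact ⟨q, by rw [hq]; push_cast; ring⟩

theorem dlcm_ne_zero (n : ℕ) : dlcm n ≠ 0 := by
  rw [dlcm, Ne, Finset.lcm_eq_zero_iff]
  simp

theorem exists_int_sum_one_div_pow {n p : ℕ} (s : Finset ℕ) (hs : ∀ i ∈ s, i < n) :
    ∃ m : ℤ, (dlcm n : ℝ) ^ p * ∑ i ∈ s, 1 / ((i : ℝ) + 1) ^ p = m := by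
  have h : ∀ i ∈ s, ∃ q : ℤ, (dlcm n : ℝ) ^ p * (1 / ((i : ℝ) + 1) ^ p) = q := by
    intro i hi
    obtain ⟨q, hq⟩ := exists_int_mul_eq_dlcm i.succ_pos (hs i hi)
    refine ⟨q ^ p, ?_⟩
    have : (i : ℝ) + 1 ≠ 0 := by positivity
    rw [hq, Nat.cast_succ, mul_pow, mul_assoc, mul_one_div_cancel (pow_ne_zero p this), mul_one,
      Int.cast_pow]
  choose! q hq using h
  exact ⟨∑ i ∈ s, q i, by rw [Finset.mul_sum, Finset.sum_congr rfl hq]; push_cast; rfl⟩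

theorem exists_tsum_beukersTerm {n r s : ℕ} (hr : r ≤ n) (hs : s ≤ n) :
    ∃ a m : ℤ, ∑' k, beukersTerm r s k = 2 * a * zetaR 3 - m / (dlcm n : ℝ) ^ 3 := by
  have hd : (dlcm n : ℝ) ≠ 0 := Nat.cast_ne_zero.2 (dlcm_ne_zero n)
  have key : ∀ {r s : ℕ}, r ≤ n → s < r → ∃ a m : ℤ,
      ∑' k, beukersTerm r s k = 2 * a * zetaR 3 - m / (dlcm n : ℝ) ^ 3 := by
    intro r s hr h
    obtain ⟨m, hm⟩ := exists_int_sum_one_div_pow (n := n) (p := 2) (Finset.Ico s r)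
      fun i hi => (Finset.mem_Ico.1 hi).2.trans_le hr
    obtain ⟨q, hq⟩ := exists_int_mul_eq_dlcm (Nat.sub_pos_of_lt h) ((Nat.sub_le r s).trans hr)
    have hrs : (r : ℝ) - s ≠ 0 := sub_ne_zero.2 (Nat.cast_lt.2 h).ne'
    rw [Nat.cast_sub h.le] at hq
    refine ⟨0, -(q * m), ?_⟩
    rw [tsum_beukersTerm_of_lt h]
    have hq' : 1 / ((r : ℝ) - s) = q / dlcm n := by
      rw [hq] at hd ⊢
      have := left_ne_zero_of_mul hd
      field_simp
    rw [hq']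
    push_cast
    rw [← hm]
    field_simp
    ring
  rcases lt_trichotomy r s with h | h | h
  · simpa only [beukersTerm_comm r s] using key hs h
  · subst h
    obtain ⟨m, hm⟩ := exists_int_sum_one_div_pow (n := n) (p := 3) (Finset.range r)
      fun i hi => (Finset.mem_range.1 hi).trans_le hr
    refine ⟨1, 2 * m, ?_⟩
    rw [tsum_beukersTerm_self]
    push_cast
    rw [← hm]
    field_simp
  · exact key hr h

theorem beukersI_eq_sum (n : ℕ) :
    beukersI n = ∑ r ∈ Finset.range (n + 1), ∑ s ∈ Finset.range (n + 1),
      ((shiftedLegendre n).coeff r * (shiftedLegendre n).coeff s : ℤ) *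
        ∑' k, beukersTerm r s k := by
  rw [beukersI_eq_legendre]
  simp only [← integral_monomial, ← integral_const_mul]
  have hint : ∀ r s : ℕ, Integrable (fun p : ℝ × ℝ × ℝ =>
      (((shiftedLegendre n).coeff r * (shiftedLegendre n).coeff s : ℤ) : ℝ) *
        (p.1 ^ r * p.2.1 ^ s / (1 - p.2.2 * (1 - p.1 * p.2.1)))) cubeMeasure :=
    fun r s => (integrable_monomial r s).const_mul _
  simp_rw [← integral_finsetSum _ fun s _ => hint _ s]
  rw [← integral_finsetSum _ fun r _ => integrable_finsetSum _ fun s _ => hint r s]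
  congr 1 with p
  simp only [aeval_eq_sum_range, natDegree_shiftedLegendre, Finset.sum_mul_sum, Finset.sum_div,
    zsmul_eq_mul]
  refine Finset.sum_congr rfl fun r _ => Finset.sum_congr rfl fun s _ => ?_
  push_cast
  ring

theorem exists_beukersI_eq (n : ℕ) : ∃ (a : ℤ) (b : ℚ),
    (∃ m : ℤ, 2 * ((dlcm n : ℚ)) ^ 3 * b = (m : ℚ)) ∧
      beukersI n = 2 * ((a : ℝ) * zetaR 3 - (b : ℝ)) := by
  have h : ∀ r s : ℕ, ∃ a m : ℤ, r ∈ Finset.range (n + 1) → s ∈ Finset.range (n + 1) →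
      ∑' k, beukersTerm r s k = 2 * a * zetaR 3 - m / (dlcm n : ℝ) ^ 3 := by
    intro r s
    by_cases hrs : r ≤ n ∧ s ≤ n
    · obtain ⟨a, m, h⟩ := exists_tsum_beukersTerm hrs.1 hrs.2
      exact ⟨a, m, fun _ _ => h⟩
    · refine ⟨0, 0, fun hr hs => ?_⟩
      rw [Finset.mem_range] at hr hs
      lia
  choose a m ham using h
  set c : ℕ → ℤ := (shiftedLegendre n).coeff
  set A : ℤ := ∑ r ∈ Finset.range (n + 1), ∑ s ∈ Finset.range (n + 1), c r * c s * a r s with hA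
  set M : ℤ := ∑ r ∈ Finset.range (n + 1), ∑ s ∈ Finset.range (n + 1), c r * c s * m r s with hM
  have hd : (dlcm n : ℚ) ≠ 0 := Nat.cast_ne_zero.2 (dlcm_ne_zero n)
  have hd' : (dlcm n : ℝ) ≠ 0 := Nat.cast_ne_zero.2 (dlcm_ne_zero n)
  refine ⟨A, M / (2 * (dlcm n : ℚ) ^ 3), ⟨M, by field_simp⟩, ?_⟩
  have hsum : beukersI n = 2 * A * zetaR 3 - M / (dlcm n : ℝ) ^ 3 := by
    rw [beukersI_eq_sum, hA, hM]
    push_cast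
    simp only [Finset.mul_sum, Finset.sum_mul, Finset.sum_div, ← Finset.sum_sub_distrib]
    refine Finset.sum_congr rfl fun r hr => Finset.sum_congr rfl fun s hs => ?_
    rw [ham r s hr hs]
    ring
  rw [hsum]
  push_cast
  field_simp

end Arithmetic

section Maximum

theorem beukersRatio_le {u v w : ℝ} (hu : u ∈ Icc (0 : ℝ) 1) (hv : v ∈ Icc (0 : ℝ) 1)
    (hw : w ∈ Icc (0 : ℝ) 1) :
    u * (1 - u) * v * (1 - v) * w * (1 - w) / (1 - w * (1 - u * v)) ≤ (√2 - 1) ^ 4 := by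
  obtain ⟨a, ha, rfl⟩ : ∃ a, 0 ≤ a ∧ a ^ 2 = u := ⟨√u, Real.sqrt_nonneg u, Real.sq_sqrt hu.1⟩
  obtain ⟨b, hb, rfl⟩ : ∃ b, 0 ≤ b ∧ b ^ 2 = v := ⟨√v, Real.sqrt_nonneg v, Real.sq_sqrt hv.1⟩
  have h2 : √2 ^ 2 = 2 := Real.sq_sqrt (by norm_num)
  have ha1 : a ≤ 1 := (sq_le_one_iff₀ ha).1 hu.2
  have hb1 : b ≤ 1 := (sq_le_one_iff₀ hb).1 hv.2
  have hw' : 0 ≤ w * (1 - w) := mul_nonneg hw.1 (sub_nonneg.2 hw.2)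
  have hD : 0 ≤ 1 - w * (1 - a ^ 2 * b ^ 2) := by
    nlinarith [hw.1, hw.2, mul_nonneg hw.1 (mul_nonneg hu.1 hv.1)]
  set s := a * b with hs
  have hs0 : 0 ≤ s := mul_nonneg ha hb
  have hs1 : s ≤ 1 := mul_le_one₀ ha1 hb hb1
  have hw2 : w * (1 - w) * (1 + s) ^ 2 ≤ 1 - w * (1 - s ^ 2) := by
    nlinarith [sq_nonneg (1 - w - w * s)]
  have huv : (1 - a ^ 2) * (1 - b ^ 2) ≤ (1 - s) ^ 2 := by
    nlinarith [sq_nonneg (a - b)]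
  have hs2 : s * (1 - s) ≤ (√2 - 1) ^ 2 * (1 + s) := by
    nlinarith [sq_nonneg (s - (√2 - 1))]
  refine div_le_of_le_mul₀ hD (by positivity) ?_
  calc a ^ 2 * (1 - a ^ 2) * b ^ 2 * (1 - b ^ 2) * w * (1 - w)
      = s ^ 2 * (w * (1 - w)) * ((1 - a ^ 2) * (1 - b ^ 2)) := by rw [hs]; ring
    _ ≤ s ^ 2 * (w * (1 - w)) * (1 - s) ^ 2 := by gcongr
    _ = w * (1 - w) * (s * (1 - s)) ^ 2 := by ring
    _ ≤ w * (1 - w) * ((√2 - 1) ^ 2 * (1 + s)) ^ 2 := by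
        have := mul_nonneg hs0 (sub_nonneg.2 hs1)
        gcongr
    _ = (√2 - 1) ^ 4 * (w * (1 - w) * (1 + s) ^ 2) := by ring
    _ ≤ (√2 - 1) ^ 4 * (1 - w * (1 - s ^ 2)) := by gcongr
    _ = (√2 - 1) ^ 4 * (1 - w * (1 - a ^ 2 * b ^ 2)) := by rw [hs]; ring

theorem sqrt_two_sub_one_mem_Ioo : √2 - 1 ∈ Ioo (0 : ℝ) 1 :=
  ⟨sub_pos.2 Real.one_lt_sqrt_two, by linarith [Real.sqrt_two_lt_three_halves]⟩

theorem sqrt_two_div_two_mem_Ioo : √2 / 2 ∈ Ioo (0 : ℝ) 1 :=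
  ⟨by positivity, by linarith [Real.sqrt_two_lt_three_halves]⟩

theorem beukersRatio_maximizer :
    (√2 - 1) * (1 - (√2 - 1)) * (√2 - 1) * (1 - (√2 - 1)) * (√2 / 2) * (1 - √2 / 2) /
      (1 - √2 / 2 * (1 - (√2 - 1) * (√2 - 1))) = (√2 - 1) ^ 4 := by
  have h2 : √2 ^ 2 = 2 := Real.sq_sqrt (by norm_num)
  have hD : 1 - √2 / 2 * (1 - (√2 - 1) * (√2 - 1)) = √2 - 1 := by
    linear_combination (√2 / 2 - 1) * h2
  rw [hD, div_eq_iff sqrt_two_sub_one_mem_Ioo.1.ne']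
  have h1 : (√2 - 1) * (1 - (√2 - 1)) = √2 * (√2 - 1) ^ 2 := by
    linear_combination (1 - √2) * h2
  have h3 : √2 / 2 * (1 - √2 / 2) = (√2 - 1) / 2 := by linear_combination (-1 / 4) * h2
  calc _ = ((√2 - 1) * (1 - (√2 - 1))) ^ 2 * (√2 / 2 * (1 - √2 / 2)) := by ring
    _ = √2 ^ 2 * ((√2 - 1) ^ 4 * ((√2 - 1) / 2)) := by rw [h1, h3]; ring
    _ = _ := by rw [h2]; ring

end Maximum

section Asymptotics

/-- Laplace's principle: `∫ fⁿ g` grows like the `n`-th power of the essential supremum of `f`. -/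
theorem tendsto_log_integral_pow_mul_div {α : Type*} [MeasurableSpace α] {μ : Measure α}
    {f g : α → ℝ} {M : ℝ} (hM : 0 < M) (hg : Integrable g μ) (hg0 : ∀ᵐ x ∂μ, 0 < g x)
    (hf : Measurable f) (hf0 : ∀ᵐ x ∂μ, 0 ≤ f x) (hfM : ∀ᵐ x ∂μ, f x ≤ M)
    (hlarge : ∀ c < M, 0 < μ {x | c < f x}) :
    Tendsto (fun n : ℕ => Real.log (∫ x, f x ^ n * g x ∂μ) / n) atTop (𝓝 (Real.log M)) := by
  have hint : ∀ n : ℕ, Integrable (fun x => f x ^ n * g x) μ := by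
    intro n
    refine (hg.const_mul (M ^ n)).mono'
      ((hf.pow_const n).aestronglyMeasurable.mul hg.aestronglyMeasurable) ?_
    filter_upwards [hg0, hf0, hfM] with x h1 h2 h3
    rw [Real.norm_of_nonneg (by positivity)]
    gcongr
  have hnonneg : ∀ n : ℕ, 0 ≤ᵐ[μ] fun x => f x ^ n * g x := by
    intro n
    filter_upwards [hg0, hf0] with x h1 h2
    simp only [Pi.zero_apply]
    positivity
  have hmeas : ∀ c, MeasurableSet {x | c < f x} := fun c => measurableSet_lt measurable_const hf
  have hpos : ∀ c < M, 0 < ∫ x in {x | c < f x}, g x ∂μ := by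
    intro c hc
    rw [integral_pos_iff_support_of_nonneg_ae
      ((ae_restrict_of_ae hg0).mono fun x hx => hx.le) hg.integrableOn]
    have : (Function.support g : Set α) =ᵐ[μ.restrict {x | c < f x}] univ :=
      eventuallyEq_univ.2 ((ae_restrict_of_ae hg0).mono fun x hx => hx.ne')
    rw [measure_congr this, Measure.restrict_apply_univ]
    exact hlarge c hc
  have hlower : ∀ c, 0 < c → ∀ n : ℕ,
      c ^ n * ∫ x in {x | c < f x}, g x ∂μ ≤ ∫ x, f x ^ n * g x ∂μ := by
    intro c hc n
    rw [← integral_const_mul]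
    refine le_trans ?_ (setIntegral_le_integral (s := {x | c < f x}) (hint n) (hnonneg n))
    refine integral_mono_ae (hg.integrableOn.const_mul _) (hint n).integrableOn ?_
    filter_upwards [ae_restrict_of_ae hg0, ae_restrict_mem (hmeas c)] with x h1 h2
    have : c < f x := h2
    gcongr
  have hupper : ∀ n : ℕ, ∫ x, f x ^ n * g x ∂μ ≤ M ^ n * ∫ x, g x ∂μ := by
    intro n
    rw [← integral_const_mul]
    refine integral_mono_ae (hint n) (hg.const_mul _) ?_
    filter_upwards [hg0, hf0, hfM] with x h1 h2 h3
    gcongr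
  have hIpos : ∀ n : ℕ, 0 < ∫ x, f x ^ n * g x ∂μ := fun n =>
    (mul_pos (pow_pos (half_pos hM) n) (hpos _ (half_lt_self hM))).trans_le
      (hlower _ (half_pos hM) n)
  have hgpos : 0 < ∫ x, g x ∂μ := by simpa using hIpos 0
  have hlim : ∀ c K : ℝ, Tendsto (fun n : ℕ => c + K / n) atTop (𝓝 c) := fun c K => by
    simpa using (tendsto_const_div_atTop_nhds_zero_nat K).const_add c
  have hlog : ∀ c K : ℝ, 0 < c → 0 < K → ∀ n : ℕ, 0 < n →
      Real.log (c ^ n * K) / n = Real.log c + Real.log K / n := by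
    intro c K hc hK n hn
    have : (n : ℝ) ≠ 0 := Nat.cast_ne_zero.2 hn.ne'
    rw [Real.log_mul (pow_pos hc n).ne' hK.ne', Real.log_pow]
    field_simp
  refine tendsto_order.2 ⟨fun a ha => ?_, fun a ha => ?_⟩
  · obtain ⟨l, hal, hlM⟩ := exists_between ha
    have hc : Real.exp l < M := (Real.lt_log_iff_exp_lt hM).1 hlM
    filter_upwards [(hlim l (Real.log (∫ x in {x | Real.exp l < f x}, g x ∂μ))).eventually_const_lt
      hal, eventually_gt_atTop 0] with n h1 hn
    refine h1.trans_le ?_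
    have := hlog _ _ (Real.exp_pos l) (hpos _ hc) n hn
    rw [Real.log_exp] at this
    rw [← this]
    exact div_le_div_of_nonneg_right (Real.log_le_log
      (mul_pos (pow_pos (Real.exp_pos l) n) (hpos _ hc)) (hlower _ (Real.exp_pos l) n))
      n.cast_nonneg
  · filter_upwards [(hlim (Real.log M) (Real.log (∫ x, g x ∂μ))).eventually_lt_const ha,
      eventually_gt_atTop 0] with n h1 hn
    refine lt_of_le_of_lt ?_ h1
    rw [← hlog _ _ hM hgpos n hn]
    exact div_le_div_of_nonneg_right (Real.log_le_log (hIpos n) (hupper n)) n.cast_nonneg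

theorem tendsto_log_beukersI_div :
    Tendsto (fun n : ℕ => Real.log (beukersI n) / n) atTop (𝓝 (Real.log ((√2 - 1) ^ 4))) := by
  let f : ℝ × ℝ × ℝ → ℝ := fun p =>
    p.1 * (1 - p.1) * p.2.1 * (1 - p.2.1) * p.2.2 * (1 - p.2.2) / (1 - p.2.2 * (1 - p.1 * p.2.1))
  let g : ℝ × ℝ × ℝ → ℝ := fun p => 1 / (1 - p.2.2 * (1 - p.1 * p.2.1))
  have hI : ∀ n, beukersI n = ∫ p, f p ^ n * g p ∂cubeMeasure := by
    intro n
    rw [beukersI_eq_iterated, ← integral_cube (f := fun u v w => (u ^ n * (1 - u) ^ n * v ^ n *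
      (1 - v) ^ n * w ^ n * (1 - w) ^ n) / (1 - w * (1 - u * v)) ^ (n + 1))
      (integrable_beukersIntegrand n)]
    congr 1 with p
    simp only [f, g, mul_pow, pow_succ, div_eq_mul_inv, mul_inv]
    ring
  simp only [hI]
  refine tendsto_log_integral_pow_mul_div (pow_pos sqrt_two_sub_one_mem_Ioo.1 4)
    (integrable_cube_mul_inv (g := fun _ _ _ => 1) measurable_const 1 (by simp)) ?_
    (by fun_prop) ?_ ?_ fun c hc => ?_
  · filter_upwards [ae_cubeMeasure] with p hp
    exact one_div_pos.2 (beukersDenom_pos hp.1.1 hp.2.1.1 hp.2.2)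
  · filter_upwards [ae_cubeMeasure] with p hp
    have hD := beukersDenom_pos hp.1.1 hp.2.1.1 hp.2.2
    obtain ⟨⟨h1, h2⟩, ⟨h3, h4⟩, ⟨h5, h6⟩⟩ := hp
    rw [← sub_pos] at h2 h4 h6
    simp only [f]
    positivity
  · filter_upwards [ae_cubeMeasure] with p hp
    exact beukersRatio_le (Ioo_subset_Icc_self hp.1) (Ioo_subset_Icc_self hp.2.1)
      (Ioo_subset_Icc_self hp.2.2)
  · let p₀ : ℝ × ℝ × ℝ := (√2 - 1, √2 - 1, √2 / 2)
    have hcube : Ioo (0 : ℝ) 1 ×ˢ (Ioo (0 : ℝ) 1 ×ˢ Ioo (0 : ℝ) 1) ∈ 𝓝 p₀ :=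
      (isOpen_Ioo.prod (isOpen_Ioo.prod isOpen_Ioo)).mem_nhds
        ⟨sqrt_two_sub_one_mem_Ioo, sqrt_two_sub_one_mem_Ioo, sqrt_two_div_two_mem_Ioo⟩
    have hcont : ContinuousAt f p₀ := by
      refine ContinuousAt.div (by fun_prop) (by fun_prop) ?_
      exact (beukersDenom_pos sqrt_two_sub_one_mem_Ioo.1 sqrt_two_sub_one_mem_Ioo.1
        sqrt_two_div_two_mem_Ioo).ne'
    have hnhds : {p | c < f p} ∈ 𝓝 p₀ :=
      hcont.eventually_const_lt (hc.trans_eq beukersRatio_maximizer.symm)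
    rw [cubeMeasure_eq_restrict, Measure.restrict_apply'
      (measurableSet_Ioo.prod (measurableSet_Ioo.prod measurableSet_Ioo))]
    exact Measure.measure_pos_of_mem_nhds _ (inter_mem hnhds hcube)

end Asymptotics

/-- (Beukers) (1) The maximum of `u(1-u)v(1-v)w(1-w)/(1-w(1-uv))` on the unit cube
equals `(√2-1)⁴`, and `(log I_n)/n → log((√2-1)⁴)`;
(2) for every `n` there are `a_n ∈ ℤ` and `b_n ∈ ℚ` with `2 d_n³ b_n ∈ ℤ` such that
`I_n = 2 (a_n ζ(3) - b_n)`. -/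
theorem beukers_integral :
    IsGreatest
      {y : ℝ | ∃ u ∈ Set.Icc (0:ℝ) 1, ∃ v ∈ Set.Icc (0:ℝ) 1, ∃ w ∈ Set.Icc (0:ℝ) 1,
        y = u * (1 - u) * v * (1 - v) * w * (1 - w) / (1 - w * (1 - u * v))}
      ((Real.sqrt 2 - 1) ^ 4) ∧
    Filter.Tendsto (fun n : ℕ => Real.log (beukersI n) / n) Filter.atTop
      (nhds (Real.log ((Real.sqrt 2 - 1) ^ 4))) ∧
    (∀ n : ℕ, ∃ (a : ℤ) (b : ℚ),
      (∃ m : ℤ, 2 * ((dlcm n : ℚ)) ^ 3 * b = (m : ℚ)) ∧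
      beukersI n = 2 * ((a : ℝ) * zetaR 3 - (b : ℝ))) := by
  refine ⟨⟨?_, ?_⟩, tendsto_log_beukersI_div, exists_beukersI_eq⟩
  · exact ⟨_, Ioo_subset_Icc_self sqrt_two_sub_one_mem_Ioo, _,
      Ioo_subset_Icc_self sqrt_two_sub_one_mem_Ioo, _,
      Ioo_subset_Icc_self sqrt_two_div_two_mem_Ioo, beukersRatio_maximizer.symm⟩
  · rintro y ⟨u, hu, v, hv, w, hw, rfl⟩
    exact beukersRatio_le hu hv hw
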